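/- Let G be a finite group. If there exists n ≥ 1 with s(n)·|G| < s(n+1), where s(n) = |{(g₁,…,gₙ) ∈ Gⁿ : g₁²⋯gₙ² = 1}|, then some irreducible character χ of G has Frobenius–Schur indicator ε(χ) = −1. -/

import Mathlib

open Matrix in
/-- If the space of invariant bilinear forms of a matrix representation is at most
one-dimensional, its Frobenius–Schur indicator is `0`, `1` or `-1`. -/
theorem Matrix.frobeniusSchur_of_invariant_forms_proportional {G ι : Type*} [Group G] [Fintype G]
    [Fintype ι] [DecidableEq ι] (R : G →* Matrix ι ι ℂ)
    (H : ∀ B C : Matrix ι ι ℂ, (∀ g, R g * B * (R g)ᵀ = B) → (∀ g, R g * C * (R g)ᵀ = C) →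
      B ≠ 0 → ∃ c : ℂ, C = c • B) :
    (Fintype.card G : ℂ)⁻¹ * ∑ g : G, (R (g ^ 2)).trace ∈ ({0, 1, -1} : Set ℂ) := by
  let S : Matrix ι ι ℂ →ₗ[ℂ] Matrix ι ι ℂ := (Fintype.card G : ℂ)⁻¹ • ∑ g : G,
    LinearMap.mulLeft ℂ (R g) ∘ₗ LinearMap.mulRight ℂ (R g)ᵀ ∘ₗ
      (transposeLinearEquiv ι ι ℂ ℂ).toLinearMap
  have hS (X) : S X = (Fintype.card G : ℂ)⁻¹ • ∑ g : G, R g * Xᵀ * (R g)ᵀ := by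
    simp [S, LinearMap.sum_apply, mul_assoc]
  have hcard : (Fintype.card G : ℂ) ≠ 0 := by simp
  have hfix (X) (h : G) : R h * S X * (R h)ᵀ = S X := by
    rw [hS, mul_smul_comm, smul_mul_assoc, Finset.mul_sum, Finset.sum_mul]
    congr 1
    refine Fintype.sum_equiv (Equiv.mulLeft h) _ _ fun g => ?_
    simp [mul_assoc]
  have htrace : LinearMap.trace ℂ _ S =
      (Fintype.card G : ℂ)⁻¹ * ∑ g : G, (R (g ^ 2)).trace := by
    have hentry (g : G) (i j : ι) :
        (R g * (single i j (1 : ℂ))ᵀ * (R g)ᵀ) i j = R g i j * R g j i := by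
      rw [transpose_single]
      simp [mul_apply, single, ite_and]
    rw [LinearMap.trace_eq_matrix_trace ℂ (Matrix.stdBasis ℂ ι ι), Matrix.trace]
    simp only [diag_apply, LinearMap.toMatrix_apply, Fintype.sum_prod_type, stdBasis_eq_single, hS]
    have hrepr (X : Matrix ι ι ℂ) (i j : ι) : (stdBasis ℂ ι ι).repr X (i, j) = X i j := by
      simp [stdBasis]
    simp only [hrepr, smul_apply, sum_apply, hentry, smul_eq_mul, ← Finset.mul_sum, sq, map_mul,
      trace, diag_apply, mul_apply]
    rw [Finset.sum_comm_cycle, Finset.sum_comm_cycle]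
  rw [← htrace]
  by_cases hB : ∃ B : Matrix ι ι ℂ, B ≠ 0 ∧ ∀ g, R g * B * (R g)ᵀ = B
  · obtain ⟨B, hB0, hB⟩ := hB
    have hBT (g : G) : R g * Bᵀ * (R g)ᵀ = Bᵀ := by
      conv_rhs => rw [← hB g]
      simp [mul_assoc]
    obtain ⟨c, hc⟩ := H B Bᵀ hB hBT hB0
    obtain ⟨i, j, hij⟩ : ∃ i j, B i j ≠ 0 := by
      by_contra! h
      exact hB0 (Matrix.ext h)
    have hc2 : c * c = 1 := by
      have h1 : c • c • B = B := by
        rw [← hc, ← transpose_smul, ← hc, transpose_transpose]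
      have := congrFun (congrFun h1 i) j
      simp only [smul_apply, smul_eq_mul, ← mul_assoc] at this
      exact mul_right_cancel₀ hij (by rw [this, one_mul])
    let φ : Matrix ι ι ℂ →ₗ[ℂ] ℂ := (B i j)⁻¹ • (entryLinearMap ℂ ℂ i j ∘ₗ S)
    have hSφ : S = φ.smulRight B := by
      ext1 X
      obtain ⟨d, hd⟩ := H B (S X) hB (hfix X) hB0
      simp [φ, hd, mul_comm d, hij]
    have hSB : S B = Bᵀ := by
      simp [hS, hBT, ← Nat.cast_smul_eq_nsmul ℂ, smul_smul]
    have htr : LinearMap.trace ℂ _ S = c := by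
      rw [hSφ, LinearMap.trace_smulRight]
      simp [φ, hSB, hc, mul_comm c, hij]
    rw [htr]
    rcases mul_self_eq_one_iff.mp hc2 with h | h <;> simp [h]
  · push Not at hB
    have hS0 : S = 0 := by
      ext1 X
      by_contra hX
      obtain ⟨g, hg⟩ := hB (S X) hX
      exact hg (hfix X g)
    simp [hS0]

open Representation in
/-- The Frobenius–Schur indicator of an irreducible representation is `0`, `1` or `-1`. -/
theorem Representation.frobeniusSchur_mem {G V : Type*} [Group G] [Fintype G] [AddCommGroup V]
    [Module ℂ V] [FiniteDimensional ℂ V] (ρ : Representation ℂ G V) [IsIrreducible ρ] :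
    (Fintype.card G : ℂ)⁻¹ * ∑ g : G, ρ.character (g ^ 2) ∈ ({0, 1, -1} : Set ℂ) := by
  classical
  let b := Module.finBasis ℂ V
  let R : G →* Matrix _ _ ℂ := (LinearMap.toMatrixAlgEquiv b).toAlgHom.toMonoidHom.comp ρ
  have hR (g : G) : ρ g = Matrix.toLin b b (R g) := (Matrix.toLin_toMatrix b b (ρ g)).symm
  have htr (g : G) : ρ.character g = (R g).trace := by
    rw [character, hR, Matrix.trace_toLin_eq]
  simp_rw [htr]
  apply Matrix.frobeniusSchur_of_invariant_forms_proportional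
  intro B C hB hC hB0
  let σ : Representation ℂ G (Fin (Module.finrank ℂ V) → ℂ) :=
    { toFun g := Matrix.toLin' (R g⁻¹).transpose
      map_one' := by simp [Module.End.one_eq_id]
      map_mul' g h := by simp [Module.End.mul_eq_comp] }
  let F (B : Matrix _ _ ℂ) (hB : ∀ g, R g * B * (R g).transpose = B) : IntertwiningMap σ ρ :=
    LinearMap.intertwiningMap_of_isIntertwiningMap σ ρ
      (Matrix.toLin (Pi.basisFun ℂ _) b B) (fun g v => by
        have hBg : B * (R g⁻¹).transpose = R g * B := by
          conv_lhs => rw [← hB g]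
          rw [Matrix.mul_assoc, ← Matrix.transpose_mul, ← map_mul, inv_mul_cancel, map_one,
            Matrix.transpose_one, mul_one]
        have h1 := Matrix.toLin_mul (Pi.basisFun ℂ _) (Pi.basisFun ℂ _) b B (R g⁻¹).transpose
        rw [hBg, Matrix.toLin_mul (Pi.basisFun ℂ _) b b, ← hR] at h1
        exact (LinearMap.congr_fun h1 v).symm)
  have hsurj : Function.Surjective (F B hB) := by
    refine (IsIrreducible.surjective_or_eq_zero (F B hB)).resolve_right fun h => hB0 ?_
    exact (map_eq_zero_iff _ (Matrix.toLin (Pi.basisFun ℂ _) b).injective).mp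
      (congrArg IntertwiningMap.toLinearMap h)
  have hbij : Function.Bijective (F B hB) :=
    ⟨(LinearMap.injective_iff_surjective_of_finrank_eq_finrank (f := (F B hB).toLinearMap)
      (by simp)).mpr hsurj, hsurj⟩
  let E := IntertwiningMap.ofBijective (F B hB) hbij
  obtain ⟨c, hc⟩ := (IsIrreducible.algebraMap_intertwiningMap_bijective_of_isAlgClosed
    (ρ := ρ)).2 ((F C hC).comp E.symm.toIntertwiningMap)
  refine ⟨c, (Matrix.toLin (Pi.basisFun ℂ _) b).injective (LinearMap.ext fun v => ?_)⟩
  have h := DFunLike.congr_fun hc (E v)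
  have hv : E.symm (E v) = v := E.toLinearEquiv.symm_apply_apply v
  change c • F B hB v = F C hC (E.symm (E v)) at h
  rw [hv] at h
  rw [map_smul]
  exact h.symm

/-- Every nonzero subrepresentation of a finite-dimensional representation contains an
irreducible one. -/
theorem Representation.exists_irreducible_le {k G V : Type*} [Field k] [Monoid G] [AddCommGroup V]
    [Module k V] [FiniteDimensional k V] {ρ : Representation k G V} (E : Subrepresentation ρ)
    (hE : E ≠ ⊥) : ∃ W ≤ E, IsIrreducible W.toRepresentation := by
  have hmono : StrictMono (Subrepresentation.toSubmodule : Subrepresentation ρ → Submodule k V) :=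
    Monotone.strictMono_of_injective (fun _ _ h => h) Subrepresentation.toSubmodule_injective
  have := hmono.wellFoundedLT
  have := isAtomic_of_orderBot_wellFounded_lt (α := Subrepresentation ρ) wellFounded_lt
  obtain ⟨W, hW, hWE⟩ := (eq_bot_or_exists_atom_le E).resolve_left hE
  refine ⟨W, hWE, ?_⟩
  have hbot : W.toSubmodule ≠ ⊥ := fun h =>
    hW.1 (Subrepresentation.toSubmodule_injective h)
  have : Nontrivial W.toSubmodule := Submodule.nontrivial_iff_ne_bot.mpr hbot
  have hne : (⊥ : Subrepresentation W.toRepresentation) ≠ ⊤ := fun h =>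
    bot_ne_top (α := Submodule k W.toSubmodule) (congrArg Subrepresentation.toSubmodule h)
  refine { toNontrivial := ⟨⊥, ⊤, hne⟩, eq_bot_or_eq_top := fun U => ?_ }
  let U' : Subrepresentation ρ :=
    { toSubmodule := U.toSubmodule.map W.toSubmodule.subtype
      apply_mem_toSubmodule := by
        rintro g _ ⟨u, hu, rfl⟩
        exact ⟨_, U.apply_mem_toSubmodule g hu, rfl⟩ }
  have hU' : U' ≤ W := Submodule.map_subtype_le (p := W.toSubmodule) U.toSubmodule
  rcases hW.le_iff.mp hU' with h | h
  · left
    apply Subrepresentation.toSubmodule_injective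
    apply Submodule.map_injective_of_injective W.toSubmodule.subtype_injective
    exact (congrArg Subrepresentation.toSubmodule h).trans (Submodule.map_bot _).symm
  · right
    apply Subrepresentation.toSubmodule_injective
    apply Submodule.map_injective_of_injective W.toSubmodule.subtype_injective
    exact (congrArg Subrepresentation.toSubmodule h).trans (Submodule.map_subtype_top _).symm

/-- An irreducible complex representation of a finite group is a simple object of `FDRep ℂ G`. -/
theorem FDRep.simple_of_isIrreducible {G V : Type} [Group G] [Fintype G] [AddCommGroup V]
    [Module ℂ V] [FiniteDimensional ℂ V] (ρ : Representation ℂ G V)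
    [Representation.IsIrreducible ρ] : CategoryTheory.Simple (FDRep.of ρ) := by
  have := invertibleOfNonzero (NeZero.ne (Nat.card G : ℂ))
  rw [FDRep.simple_iff_char_is_norm_one]
  have h := Representation.char_orthonormal ρ ρ
  rw [if_pos ⟨.refl _⟩, inv_mul_eq_one₀ (NeZero.ne _)] at h
  exact h.symm

/-- If no irreducible representation has Frobenius–Schur indicator `-1`, every eigenvalue of the
sum of the squares of the group elements lies between `0` and the order of the group. -/
theorem Representation.eigenvalue_sum_sq_bounds {G V : Type} [Group G] [Fintype G]
    [AddCommGroup V] [Module ℂ V] [FiniteDimensional ℂ V] (ρ : Representation ℂ G V)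
    (hG : ∀ W : FDRep ℂ G, CategoryTheory.Simple W →
      (Fintype.card G : ℂ)⁻¹ * ∑ g : G, W.character (g ^ 2) ≠ -1)
    (μ : ℝ) (v : V) (hv : v ≠ 0) (hμ : ∑ g : G, ρ (g ^ 2) v = (μ : ℂ) • v) :
    0 ≤ μ ∧ μ ≤ Fintype.card G := by
  let T : V →ₗ[ℂ] V := ∑ g : G, ρ (g ^ 2)
  have hT (w : V) : T w = ∑ g : G, ρ (g ^ 2) w := by simp [T, LinearMap.sum_apply]
  have hcomm (h : G) (w : V) : T (ρ h w) = ρ h (T w) := by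
    rw [hT, hT, map_sum]
    refine Fintype.sum_equiv (MulAut.conj h⁻¹).toEquiv _ _ fun g => ?_
    simp only [← Module.End.mul_apply, ← map_mul]
    simp [sq, mul_assoc]
  let E : Subrepresentation ρ :=
    { toSubmodule := Module.End.eigenspace T μ
      apply_mem_toSubmodule := fun g w hw => by
        rw [Module.End.mem_eigenspace_iff] at hw ⊢
        rw [hcomm, hw, map_smul] }
  have hE : E ≠ ⊥ := by
    intro h
    have hvE : v ∈ E.toSubmodule := Module.End.mem_eigenspace_iff.mpr ((hT v).trans hμ)
    rw [h] at hvE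
    exact hv ((Submodule.mem_bot ℂ).mp hvE)
  obtain ⟨W, hWE, hW⟩ := exists_irreducible_le E hE
  have hne := hG _ (FDRep.simple_of_isIrreducible W.toRepresentation)
  have hmem := frobeniusSchur_mem W.toRepresentation
  change (Fintype.card G : ℂ)⁻¹ * ∑ g : G, W.toRepresentation.character (g ^ 2) ≠ -1 at hne
  have hsum : ∑ g : G, W.toRepresentation.character (g ^ 2) =
      μ * Module.finrank ℂ W.toSubmodule := by
    have : ∑ g : G, W.toRepresentation (g ^ 2) = (μ : ℂ) • 1 := by
      ext w
      have := Module.End.mem_eigenspace_iff.mp (hWE w.2)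
      rw [hT] at this
      simp only [LinearMap.sum_apply, AddSubmonoidClass.coe_finsetSum]
      exact this
    have h2 := congrArg (LinearMap.trace ℂ _) this
    rw [map_sum, map_smul, LinearMap.trace_one, smul_eq_mul] at h2
    exact h2
  have hd : 1 ≤ Module.finrank ℂ W.toSubmodule := by
    have : Nontrivial (Subrepresentation W.toRepresentation) := hW.toNontrivial
    rw [Nat.one_le_iff_ne_zero]
    intro h0
    have := Module.finrank_zero_iff.mp h0
    apply not_subsingleton (Subrepresentation W.toRepresentation)
    exact Subrepresentation.toSubmodule_injective.subsingleton
  have hn : (0 : ℝ) < Fintype.card G := by exact_mod_cast Fintype.card_pos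
  have hnC : (Fintype.card G : ℂ) ≠ 0 := by simp
  have hdR : (1 : ℝ) ≤ Module.finrank ℂ W.toSubmodule := by exact_mod_cast hd
  rw [hsum] at hmem hne
  rcases hmem with h | h | h
  · have : μ * Module.finrank ℂ W.toSubmodule = 0 := by
      replace h := (mul_eq_zero.mp h).resolve_left (inv_ne_zero hnC)
      exact_mod_cast h
    have : μ = 0 := by
      rcases mul_eq_zero.mp this with h | h
      · exact h
      · linarith
    exact ⟨this.ge, this ▸ hn.le⟩
  · have : μ * Module.finrank ℂ W.toSubmodule = Fintype.card G := by
      rw [inv_mul_eq_one₀ hnC] at h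
      exact_mod_cast h.symm
    have hμ0 : 0 ≤ μ := by
      by_contra! h
      nlinarith
    exact ⟨hμ0, by nlinarith⟩
  · exact absurd h hne

section

open Matrix

/-- The left regular representation, in matrix form. -/
def leftRegularMatrix (G : Type*) [Group G] [Fintype G] [DecidableEq G] : G →* Matrix G G ℂ where
  toFun g := of fun a b => if a = g * b then 1 else 0
  map_one' := by ext; simp [one_apply]
  map_mul' g h := by ext; simp [mul_apply, mul_assoc]

theorem leftRegularMatrix_trace {G : Type*} [Group G] [Fintype G] [DecidableEq G] (g : G) :
    (leftRegularMatrix G g).trace = if g = 1 then (Fintype.card G : ℂ) else 0 := by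
  split_ifs with h <;> simp [leftRegularMatrix, trace, h]

theorem leftRegularMatrix_conjTranspose {G : Type*} [Group G] [Fintype G] [DecidableEq G] (g : G) :
    (leftRegularMatrix G g)ᴴ = leftRegularMatrix G g⁻¹ := by
  ext a b
  simp [leftRegularMatrix, eq_inv_mul_iff_mul_eq, eq_comm, apply_ite]

theorem sum_map_sq_pow {G A : Type*} [Group G] [Fintype G] [Semiring A] (f : G →* A) (n : ℕ) :
    (∑ g, f (g ^ 2)) ^ n =
      ∑ v : Fin n → G, f ((List.ofFn v).map fun g => g ^ 2).prod := by
  induction n with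
  | zero => simp
  | succ n ih =>
    rw [pow_succ', ih, Finset.sum_mul_sum, ← (Fin.consEquiv fun _ => G).sum_comp,
      Fintype.sum_prod_type]
    simp [Fin.consEquiv, List.ofFn_succ]

theorem trace_pow_sum_leftRegularMatrix {G : Type*} [Group G] [Fintype G] [DecidableEq G] (n : ℕ) :
    ((∑ g, leftRegularMatrix G (g ^ 2)) ^ n).trace = Fintype.card G *
      (Nat.card {v : Fin n → G // ((List.ofFn v).map fun g => g ^ 2).prod = 1} : ℂ) := by
  rw [sum_map_sq_pow, trace_sum]
  simp only [leftRegularMatrix_trace, Nat.card_eq_fintype_card, Fintype.card_subtype]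
  rw [← Finset.sum_filter, Finset.sum_const, nsmul_eq_mul, mul_comm]

/-- The trace of a power of a Hermitian matrix is the corresponding power sum of the eigenvalues. -/
theorem Matrix.IsHermitian.trace_pow {n 𝕜 : Type*} [RCLike 𝕜] [Fintype n] [DecidableEq n]
    {A : Matrix n n 𝕜} (hA : A.IsHermitian) (k : ℕ) :
    (A ^ k).trace = ∑ i, (hA.eigenvalues i : 𝕜) ^ k := by
  conv_lhs => rw [hA.spectral_theorem, ← map_pow, Unitary.conjStarAlgAut_apply]
  rw [trace_mul_comm, ← mul_assoc]
  simp [diagonal_pow, trace_diagonal]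

end

/-- If `s(n)·|G| < s(n+1)` for some `n ≥ 1`, then some irreducible character of `G` has
Frobenius–Schur indicator `-1`. -/
theorem stmt_12 {G : Type} [Group G] [Fintype G] (n : ℕ) (hn : 1 ≤ n)
    (h : Nat.card {v : Fin n → G // ((List.ofFn v).map fun g => g ^ 2).prod = 1} * Fintype.card G <
      Nat.card {v : Fin (n + 1) → G // ((List.ofFn v).map fun g => g ^ 2).prod = 1}) :
    ∃ V : FDRep ℂ G, CategoryTheory.Simple V ∧
      (Fintype.card G : ℂ)⁻¹ * ∑ g : G, V.character (g ^ 2) = -1 := by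
  classical
  by_contra! hG
  let A : Matrix G G ℂ := ∑ g, leftRegularMatrix G (g ^ 2)
  have hA : A.IsHermitian := by
    rw [Matrix.IsHermitian, Matrix.conjTranspose_sum]
    exact Fintype.sum_equiv (Equiv.inv G) _ _ fun g => by
      rw [leftRegularMatrix_conjTranspose, Equiv.inv_apply, inv_pow]
  let ρ : Representation ℂ G (G → ℂ) :=
    (Matrix.toLinAlgEquiv' : Matrix G G ℂ ≃ₐ[ℂ] _).toAlgHom.toMonoidHom.comp (leftRegularMatrix G)
  have hbound (i : G) : 0 ≤ hA.eigenvalues i ∧ hA.eigenvalues i ≤ Fintype.card G := by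
    refine ρ.eigenvalue_sum_sq_bounds hG _ (hA.eigenvectorBasis i).ofLp ?_ ?_
    · intro h0
      exact hA.eigenvectorBasis.toBasis.ne_zero i (by simpa using h0)
    · have := hA.mulVec_eigenvectorBasis i
      simp only [A, Matrix.sum_mulVec] at this
      exact this
  have hs (m : ℕ) : Fintype.card G *
      (Nat.card {v : Fin m → G // ((List.ofFn v).map fun g => g ^ 2).prod = 1} : ℝ) =
      ∑ i, hA.eigenvalues i ^ m := by
    have h1 := (trace_pow_sum_leftRegularMatrix (G := G) m).symm.trans (hA.trace_pow m)
    simp only [Complex.coe_algebraMap] at h1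
    exact_mod_cast h1
  have hle : ∑ i, hA.eigenvalues i ^ (n + 1) ≤ (∑ i, hA.eigenvalues i ^ n) * Fintype.card G := by
    rw [Finset.sum_mul]
    refine Finset.sum_le_sum fun i _ => ?_
    rw [pow_succ]
    exact mul_le_mul_of_nonneg_left (hbound i).2 (pow_nonneg (hbound i).1 n)
  rw [← hs, ← hs, mul_assoc] at hle
  have hpos : (0 : ℝ) < Fintype.card G := by exact_mod_cast Fintype.card_pos
  have := le_of_mul_le_mul_left hle hpos
  exact absurd h (not_lt.mpr (by exact_mod_cast this))
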